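/- Mixed odd moments (Lemma 4, odd case): for every fixed s ≥ 0 and l ≥ 0, the expectation ⟨S_{2,n}^l·(S_{2,n} − n/4)^{2s+1}⟩ under P_n is asymptotically equivalent, as n → ∞, to (n/4)^l·((2s+1)!!/(2·4^{2s+1}))·(2l+1)·n^s. -/

import Mathlib

open MeasureTheory ProbabilityTheory Filter
open scoped NNReal Topology

/-- Binary trees: every internal node has exactly two children. -/
inductive BinTree : Type
  | leaf : BinTree
  | node : BinTree → BinTree → BinTree
  deriving DecidableEq

namespace BinTree

/-- The magnitude of a binary tree is its number of leaves. -/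
def magnitude : BinTree → ℕ
  | leaf => 1
  | node l r => magnitude l + magnitude r

/-- The Horton–Strahler order of (the root of) a binary tree:
leaves have order 1; a node whose two children have distinct orders has the max of the two;
a node whose two children have equal order `r` has order `r + 1`. -/
def ord : BinTree → ℕ
  | leaf => 1
  | node l r => if ord l = ord r then ord l + 1 else max (ord l) (ord r)

/-- `branches k τ` is `S_{k,n}(τ)`, the number of Horton–Strahler branches of order `k`
in `τ`, i.e. the number of maximal connected paths of nodes of order `k`.  It counts the
nodes of order `k` that head a branch: a new branch head of order `ord l + 1` is created
exactly at a node whose two children have equal order `ord l`, and every leaf heads an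
order-1 branch. -/
def branches (k : ℕ) : BinTree → ℕ
  | leaf => if k = 1 then 1 else 0
  | node l r => branches k l + branches k r +
      (if ord l = ord r ∧ ord l + 1 = k then 1 else 0)

end BinTree

/-- `treesOf n` is the finite set `Ω_n` of binary trees of magnitude `n`. -/
def treesOf : ℕ → Finset BinTree
  | 0 => ∅
  | 1 => {BinTree.leaf}
  | (n+2) => (Finset.range (n+1)).attach.biUnion fun k =>
      ((treesOf (k.1+1)) ×ˢ (treesOf (n+1-k.1))).image fun p => BinTree.node p.1 p.2
  decreasing_by
  · have := Finset.mem_range.mp k.2; omega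
  · omega

/-- Expectation `⟨f⟩` under the uniform probability measure `P_n` on `Ω_n` (the random model). -/
noncomputable def expect (n : ℕ) (f : BinTree → ℝ) : ℝ :=
  (∑ τ ∈ treesOf n, f τ) / (treesOf n).card

namespace BinTree

theorem magnitude_pos (τ : BinTree) : 0 < τ.magnitude := by
  induction τ with
  | leaf => simp [magnitude]
  | node l r hl hr => simp only [magnitude]; omega

theorem ord_pos (τ : BinTree) : 0 < τ.ord := by
  cases τ with
  | leaf => simp [ord]
  | node l r =>
    have := ord_pos l
    simp only [ord]
    split_ifs <;> omega

theorem ord_eq_one_iff (τ : BinTree) : τ.ord = 1 ↔ τ.magnitude = 1 := by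
  cases τ with
  | leaf => simp [ord, magnitude]
  | node l r =>
    have h1 := ord_pos l
    have h2 := ord_pos r
    have h3 := magnitude_pos l
    have h4 := magnitude_pos r
    simp only [ord, magnitude]
    split_ifs <;> omega

theorem branches_two_node (l r : BinTree) :
    branches 2 (node l r) = branches 2 l + branches 2 r +
      (if (node l r).magnitude = 2 then 1 else 0) := by
  have h : (ord l = ord r ∧ ord l + 1 = 2) ↔ (node l r).magnitude = 2 := by
    have hl := ord_eq_one_iff l
    have hr := ord_eq_one_iff r
    have h1 := magnitude_pos l
    have h2 := magnitude_pos r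
    simp only [magnitude]
    omega
  simp only [branches, h]

theorem eq_leaf_of_magnitude_eq_one {τ : BinTree} (h : τ.magnitude = 1) : τ = leaf := by
  cases τ with
  | leaf => rfl
  | node l r =>
    have h1 := magnitude_pos l
    have h2 := magnitude_pos r
    simp only [magnitude] at h
    omega

end BinTree

open BinTree

theorem mem_treesOf (n : ℕ) (τ : BinTree) : τ ∈ treesOf n ↔ τ.magnitude = n := by
  induction n using Nat.strong_induction_on generalizing τ with
  | _ n ih =>
    match n with
    | 0 => simpa [treesOf] using (magnitude_pos τ).ne'
    | 1 =>
      simp only [treesOf, Finset.mem_singleton]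
      exact ⟨fun h => by simp [h, magnitude], eq_leaf_of_magnitude_eq_one⟩
    | n + 2 =>
      simp only [treesOf, Finset.mem_biUnion, Finset.mem_attach, true_and, Finset.mem_image,
        Finset.mem_product, Subtype.exists, Finset.mem_range, Prod.exists]
      constructor
      · rintro ⟨k, hk, l, r, ⟨hl, hr⟩, rfl⟩
        rw [ih _ (by omega)] at hl hr
        simp only [magnitude]
        omega
      · cases τ with
        | leaf => intro h; simp [magnitude] at h
        | node l r =>
          intro h
          have h1 := magnitude_pos l
          have h2 := magnitude_pos r
          simp only [magnitude] at h
          refine ⟨l.magnitude - 1, by omega, l, r, ⟨?_, ?_⟩, rfl⟩ <;>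
          · rw [ih _ (by omega)]
            omega

theorem treesOf_add_two (n : ℕ) :
    treesOf (n + 2) = (Finset.HasAntidiagonal.antidiagonal (n + 2)).biUnion fun ij =>
      (treesOf ij.1 ×ˢ treesOf ij.2).image fun p => node p.1 p.2 := by
  ext τ
  simp only [Finset.mem_biUnion, Finset.HasAntidiagonal.mem_antidiagonal, Finset.mem_image, Finset.mem_product,
    mem_treesOf, Prod.exists]
  constructor
  · cases τ with
    | leaf => intro h; simp [magnitude] at h
    | node l r => exact fun h => ⟨_, _, h, l, r, ⟨rfl, rfl⟩, rfl⟩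
  · rintro ⟨i, j, h, l, r, ⟨rfl, rfl⟩, rfl⟩
    exact h

theorem sum_treesOf_add_two {M : Type*} [AddCommMonoid M] (n : ℕ) (f : BinTree → M) :
    ∑ τ ∈ treesOf (n + 2), f τ = ∑ ij ∈ Finset.HasAntidiagonal.antidiagonal (n + 2),
      ∑ l ∈ treesOf ij.1, ∑ r ∈ treesOf ij.2, f (node l r) := by
  rw [treesOf_add_two, Finset.sum_biUnion]
  · refine Finset.sum_congr rfl fun ij _ => ?_
    rw [Finset.sum_image, Finset.sum_product]
    rintro ⟨a, b⟩ _ ⟨c, d⟩ _ h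
    simpa using h
  · intro a _ b _ hab
    refine Finset.disjoint_left.2 fun τ ha hb => hab ?_
    simp only [Finset.mem_image, Finset.mem_product, mem_treesOf, Prod.exists] at ha hb
    obtain ⟨l, r, ⟨hl, hr⟩, rfl⟩ := ha
    obtain ⟨l', r', ⟨hl', hr'⟩, h⟩ := hb
    cases h
    exact Prod.ext (hl.symm.trans hl') (hr.symm.trans hr')

theorem treesOf_nonempty {n : ℕ} (hn : 1 ≤ n) : (treesOf n).Nonempty := by
  induction n, hn using Nat.le_induction with
  | base => exact ⟨leaf, by simp [mem_treesOf, magnitude]⟩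
  | succ n _ ih =>
    obtain ⟨τ, h⟩ := ih
    rw [mem_treesOf] at h
    exact ⟨node τ leaf, by simp [mem_treesOf, magnitude, h]⟩

section GeneratingFunction

open Polynomial PowerSeries

/-- The generating function of binary trees: the power series variable marks leaves, the
polynomial variable marks branches of order two. -/
noncomputable def treeSeries : PowerSeries ℝ[X] :=
  PowerSeries.mk fun n => ∑ τ ∈ treesOf n, (Polynomial.X : ℝ[X]) ^ branches 2 τ

theorem treeSeries_eq :
    treeSeries = PowerSeries.X + treeSeries * treeSeries
      + (PowerSeries.C (Polynomial.X : ℝ[X]) - 1) * PowerSeries.X ^ 2 := by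
  ext1 n
  have hC : (PowerSeries.C (Polynomial.X : ℝ[X]) - 1) * PowerSeries.X ^ 2
      = PowerSeries.C (Polynomial.X - 1 : ℝ[X]) * PowerSeries.X ^ 2 := by simp
  rw [hC]
  simp only [map_add, PowerSeries.coeff_C_mul, PowerSeries.coeff_X_pow, PowerSeries.coeff_X]
  rw [PowerSeries.coeff_mul]
  simp only [treeSeries, PowerSeries.coeff_mk]
  match n with
  | 0 => simp [treesOf]
  | 1 => simp [treesOf, branches, Finset.Nat.antidiagonal_succ]
  | 2 =>
    rw [show (2 : ℕ) = 0 + 2 from rfl, sum_treesOf_add_two]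
    simp [Finset.Nat.antidiagonal_succ, treesOf, branches, ord]
  | n + 3 =>
    rw [show n + 3 = (n + 1) + 2 from rfl, sum_treesOf_add_two]
    simp only [show n + 1 + 2 ≠ 1 by omega, show n + 1 + 2 ≠ 2 by omega, if_false, mul_zero,
      add_zero, zero_add]
    refine Finset.sum_congr rfl fun ij hij => ?_
    rw [Finset.sum_mul_sum]
    refine Finset.sum_congr rfl fun l hl => Finset.sum_congr rfl fun r hr => ?_
    rw [mem_treesOf] at hl hr
    rw [Finset.HasAntidiagonal.mem_antidiagonal] at hij
    rw [branches_two_node, if_neg (by simp only [magnitude]; omega), add_zero, pow_add]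

/-- Coefficientwise derivative, i.e. `∂/∂u` for the polynomial variable `u`. -/
noncomputable def coeffDeriv (f : PowerSeries ℝ[X]) : PowerSeries ℝ[X] :=
  PowerSeries.mk fun n => derivative (PowerSeries.coeff n f)

/-- The operator `z ∂/∂z - 2 u ∂/∂u`, where `z` is the power series variable and `u` the
polynomial variable. -/
noncomputable def eulerOp (f : PowerSeries ℝ[X]) : PowerSeries ℝ[X] :=
  PowerSeries.mk fun n =>
    (n : ℝ[X]) * PowerSeries.coeff n f
      - 2 * Polynomial.X * derivative (PowerSeries.coeff n f)

theorem coeffDeriv_add (f g : PowerSeries ℝ[X]) :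
    coeffDeriv (f + g) = coeffDeriv f + coeffDeriv g := by
  ext1 n; simp [coeffDeriv]

theorem coeffDeriv_sub (f g : PowerSeries ℝ[X]) :
    coeffDeriv (f - g) = coeffDeriv f - coeffDeriv g := by
  ext1 n; simp [coeffDeriv]

theorem coeffDeriv_mul (f g : PowerSeries ℝ[X]) :
    coeffDeriv (f * g) = coeffDeriv f * g + f * coeffDeriv g := by
  ext1 n
  simp [coeffDeriv, PowerSeries.coeff_mul, derivative_mul, Finset.sum_add_distrib]

theorem coeffDeriv_X : coeffDeriv PowerSeries.X = 0 := by
  ext1 n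
  simp only [coeffDeriv, PowerSeries.coeff_mk, PowerSeries.coeff_X, map_zero]
  split_ifs <;> simp

theorem coeffDeriv_C (p : ℝ[X]) : coeffDeriv (PowerSeries.C p) = PowerSeries.C (derivative p) := by
  ext1 n
  simp only [coeffDeriv, PowerSeries.coeff_mk, PowerSeries.coeff_C]
  split_ifs <;> simp

theorem coeffDeriv_one : coeffDeriv 1 = 0 := by
  rw [← map_one (PowerSeries.C (R := ℝ[X])), coeffDeriv_C]; simp

theorem eulerOp_add (f g : PowerSeries ℝ[X]) : eulerOp (f + g) = eulerOp f + eulerOp g := by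
  ext1 n; simp [eulerOp]; ring

theorem eulerOp_sub (f g : PowerSeries ℝ[X]) : eulerOp (f - g) = eulerOp f - eulerOp g := by
  ext1 n; simp [eulerOp]; ring

theorem eulerOp_mul (f g : PowerSeries ℝ[X]) :
    eulerOp (f * g) = eulerOp f * g + f * eulerOp g := by
  ext1 n
  simp only [eulerOp, PowerSeries.coeff_mul, PowerSeries.coeff_mk, map_add, derivative_sum,
    derivative_mul, Finset.mul_sum, ← Finset.sum_add_distrib, ← Finset.sum_sub_distrib]
  refine Finset.sum_congr rfl fun ij hij => ?_
  rw [← Finset.HasAntidiagonal.mem_antidiagonal.1 hij]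
  push_cast
  ring

theorem eulerOp_X : eulerOp PowerSeries.X = PowerSeries.X := by
  ext1 n
  simp only [eulerOp, PowerSeries.coeff_mk, PowerSeries.coeff_X]
  split_ifs with h <;> simp [h]

theorem eulerOp_C_X : eulerOp (PowerSeries.C (Polynomial.X : ℝ[X]))
    = -2 * PowerSeries.C (Polynomial.X : ℝ[X]) := by
  ext1 n
  rw [show (-2 : PowerSeries ℝ[X]) = PowerSeries.C (-2 : ℝ[X]) by
    rw [map_neg, map_ofNat], PowerSeries.coeff_C_mul]
  simp only [eulerOp, PowerSeries.coeff_mk, PowerSeries.coeff_C]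
  split_ifs with h <;> simp [h]

theorem eulerOp_one : eulerOp 1 = 0 := by
  ext1 n
  simp only [eulerOp, PowerSeries.coeff_mk, PowerSeries.coeff_one]
  split_ifs with h <;> simp [h]

/-- A linear second order differential equation for the generating function, derived from the fact
that `Y = 1 - 2 T` is a square root of the discriminant. -/
theorem treeSeries_pde :
    4 * PowerSeries.C (Polynomial.X : ℝ[X]) * coeffDeriv (coeffDeriv treeSeries)
      = eulerOp (eulerOp treeSeries) - eulerOp treeSeries := by
  set T := treeSeries
  set z : PowerSeries ℝ[X] := PowerSeries.X
  set u : PowerSeries ℝ[X] := PowerSeries.C (Polynomial.X : ℝ[X]) with hu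
  set Y := 1 - (T + T) with hY
  have hYY : Y * Y = (1 - (z + z)) * (1 - (z + z)) - u * ((z + z) * (z + z)) := by
    have := treeSeries_eq
    linear_combination (-4) * this
  have hDz : coeffDeriv z = 0 := coeffDeriv_X
  have hDu : coeffDeriv u = 1 := by rw [hu, coeffDeriv_C]; simp
  have hEz : eulerOp z = z := eulerOp_X
  have hEu : eulerOp u = -2 * u := eulerOp_C_X
  have two_ne : (2 : PowerSeries ℝ[X]) ≠ 0 := by
    rw [← map_ofNat (PowerSeries.C (R := ℝ[X])) 2]
    exact (map_ne_zero_iff _ PowerSeries.C_injective).2 two_ne_zero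
  have H1 : Y * coeffDeriv Y = -(z * z + z * z) := by
    have h := congrArg coeffDeriv hYY
    simp only [coeffDeriv_mul, coeffDeriv_sub, coeffDeriv_add, coeffDeriv_one, hDz, hDu] at h
    refine mul_left_cancel₀ two_ne ?_
    linear_combination h
  have H2 : Y * eulerOp Y = (z * z + z * z) + (z * z + z * z) - (z + z) := by
    have h := congrArg eulerOp hYY
    simp only [eulerOp_mul, eulerOp_sub, eulerOp_add, eulerOp_one, hEz, hEu] at h
    refine mul_left_cancel₀ two_ne ?_
    linear_combination h
  have hD0 : coeffDeriv 0 = 0 := by simpa using coeffDeriv_sub 0 0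
  have H3 : coeffDeriv Y * coeffDeriv Y + Y * coeffDeriv (coeffDeriv Y) = 0 := by
    have h := congrArg coeffDeriv H1
    rw [coeffDeriv_mul] at h
    rw [h, ← zero_sub, coeffDeriv_sub, coeffDeriv_add, coeffDeriv_mul, hDz, hD0]
    ring
  have H4 : eulerOp Y * eulerOp Y + Y * eulerOp (eulerOp Y) = 8 * z ^ 2 - 2 * z := by
    have h := congrArg eulerOp H2
    rw [eulerOp_mul] at h
    rw [h]
    simp only [eulerOp_sub, eulerOp_add, eulerOp_mul, hEz]
    ring
  have hY0 : Y ≠ 0 := by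
    intro h
    have := congrArg (PowerSeries.coeff 0) h
    simp [hY, T, treeSeries, treesOf] at this
  have key : 4 * u * coeffDeriv (coeffDeriv Y) - (eulerOp (eulerOp Y) - eulerOp Y) = 0 := by
    refine (mul_eq_zero.1 ?_).resolve_left (pow_ne_zero 3 hY0)
    linear_combination 4 * u * Y ^ 2 * H3 - 4 * u * (Y * coeffDeriv Y - 2 * z ^ 2) * H1
      - Y ^ 2 * H4 + (Y * eulerOp Y - 2 * z + 4 * z ^ 2) * H2 + Y ^ 2 * H2 - 4 * z ^ 2 * hYY
  have hDDY : coeffDeriv (coeffDeriv Y) = -2 * coeffDeriv (coeffDeriv T) := by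
    rw [hY, coeffDeriv_sub, coeffDeriv_one, coeffDeriv_sub, coeffDeriv_add, coeffDeriv_add, hD0]
    ring
  have hE0 : eulerOp 0 = 0 := by simpa using eulerOp_sub 0 0
  have hEY : eulerOp Y = 0 - (eulerOp T + eulerOp T) := by
    rw [hY, eulerOp_sub, eulerOp_one, eulerOp_add]
  have hEEY : eulerOp (eulerOp Y) = -2 * eulerOp (eulerOp T) := by
    rw [hEY, eulerOp_sub, eulerOp_add, hE0]
    ring
  rw [hDDY, hEEY, hEY] at key
  refine mul_left_cancel₀ two_ne ?_
  linear_combination -key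

/-- A Stein-type identity for the number of branches of order two. -/
theorem sum_treesOf_stein (n : ℕ) (f : ℕ → ℝ) :
    ∑ τ ∈ treesOf n,
        4 * (branches 2 τ : ℝ) * ((branches 2 τ : ℝ) - 1) * f (branches 2 τ - 1)
      = ∑ τ ∈ treesOf n,
        ((n : ℝ) - 2 * branches 2 τ) * ((n : ℝ) - 2 * branches 2 τ - 1) * f (branches 2 τ) := by
  have h := congrArg (PowerSeries.coeff n) treeSeries_pde
  have h4 : (4 : PowerSeries ℝ[X]) * PowerSeries.C (Polynomial.X : ℝ[X])
      = PowerSeries.C (4 * Polynomial.X : ℝ[X]) := by rw [map_mul, map_ofNat]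
  rw [h4, PowerSeries.coeff_C_mul] at h
  simp only [coeffDeriv, eulerOp, treeSeries, PowerSeries.coeff_mk, map_sub] at h
  let L : ℝ[X] →ₗ[ℝ] ℝ := (Polynomial.basisMonomials ℝ).constr ℝ f
  have hL (m : ℕ) (a : ℝ) : L (Polynomial.monomial m a) = a * f m := by
    have h1 : L (Polynomial.monomial m 1) = f m := by
      simpa using (Polynomial.basisMonomials ℝ).constr_basis ℝ f m
    rw [← h1, ← smul_eq_mul, ← map_smul, Polynomial.smul_monomial, smul_eq_mul, mul_one]
  let A : ℝ[X] →ₗ[ℝ] ℝ[X] :=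
    LinearMap.mulLeft ℝ (n : ℝ[X]) - LinearMap.mulLeft ℝ (2 * Polynomial.X) ∘ₗ derivative
  let B : ℝ[X] →ₗ[ℝ] ℝ[X] := LinearMap.mulLeft ℝ (4 * Polynomial.X) ∘ₗ derivative ∘ₗ derivative
  have hA (m : ℕ) (a : ℝ) :
      A (Polynomial.monomial m a) = Polynomial.monomial m ((n - 2 * m) * a) := by
    simp only [A, LinearMap.sub_apply, LinearMap.comp_apply, LinearMap.mulLeft_apply,
      derivative_monomial]
    rw [mul_assoc, Polynomial.X_mul_monomial, ← C_eq_natCast, ← Polynomial.C_ofNat,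
      C_mul_monomial, C_mul_monomial]
    cases m with
    | zero => simp
    | succ m =>
      rw [Nat.add_sub_cancel, ← map_sub]
      congr 1
      simp
      ring
  have hB (m : ℕ) (a : ℝ) :
      B (Polynomial.monomial m a) = Polynomial.monomial (m - 1) (4 * m * (m - 1) * a) := by
    simp only [B, LinearMap.comp_apply, LinearMap.mulLeft_apply, derivative_monomial]
    rw [mul_assoc, Polynomial.X_mul_monomial, ← Polynomial.C_ofNat, C_mul_monomial]
    match m with
    | 0 => simp
    | 1 => simp
    | m + 2 =>
      simp only [Nat.add_sub_cancel, show m + 2 - 1 = m + 1 by omega]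
      congr 1
      push_cast
      ring
  have h' : B (∑ τ ∈ treesOf n, Polynomial.X ^ branches 2 τ)
      = A (A (∑ τ ∈ treesOf n, Polynomial.X ^ branches 2 τ))
        - A (∑ τ ∈ treesOf n, Polynomial.X ^ branches 2 τ) := by
    simp only [A, B, LinearMap.sub_apply, LinearMap.comp_apply, LinearMap.mulLeft_apply]
    rw [h, map_sub]
  have h2 := congrArg L h'
  simp only [Polynomial.X_pow_eq_monomial, map_sum, map_sub, hA, hB, hL,
    ← Finset.sum_sub_distrib] at h2
  convert h2 using 2 <;> ring

end GeneratingFunction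

/-- The `k`-th moment of `S_{2,n} - n/4`. -/
noncomputable def centredMoment (k n : ℕ) : ℝ :=
  expect n fun τ => ((branches 2 τ : ℝ) - (n : ℝ) / 4) ^ k

theorem centredMoment_zero {n : ℕ} (hn : 1 ≤ n) : centredMoment 0 n = 1 := by
  have := (treesOf_nonempty hn).card_pos
  simp [centredMoment, expect, this.ne']

theorem centredMoment_succ (k n : ℕ) :
    (4 * (n : ℝ) - 6) * centredMoment (k + 1) n = (n : ℝ) / 2 * centredMoment k n
      - ∑ j ∈ Finset.range k, (-1) ^ (k - j) * (k.choose j : ℝ) *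
        (4 * centredMoment (j + 2) n + (2 * (n : ℝ) - 4) * centredMoment (j + 1) n
          + ((n : ℝ) ^ 2 / 4 - n) * centredMoment j n) := by
  set x : BinTree → ℝ := fun τ => (branches 2 τ : ℝ) - (n : ℝ) / 4 with hx
  have key : (4 * (n : ℝ) - 6) * ∑ τ ∈ treesOf n, x τ ^ (k + 1)
      = (n : ℝ) / 2 * ∑ τ ∈ treesOf n, x τ ^ k
      - ∑ j ∈ Finset.range k, (-1) ^ (k - j) * (k.choose j : ℝ) *
        (4 * ∑ τ ∈ treesOf n, x τ ^ (j + 2)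
          + (2 * (n : ℝ) - 4) * ∑ τ ∈ treesOf n, x τ ^ (j + 1)
          + ((n : ℝ) ^ 2 / 4 - n) * ∑ τ ∈ treesOf n, x τ ^ j) := by
    simp only [Finset.mul_sum, ← Finset.sum_add_distrib]
    rw [Finset.sum_comm, ← Finset.sum_sub_distrib, ← sub_eq_zero, ← Finset.sum_sub_distrib]
    have stein := sum_treesOf_stein n fun m => ((m : ℝ) - (n : ℝ) / 4) ^ k
    rw [← sub_eq_zero, ← Finset.sum_sub_distrib] at stein
    rw [← stein]
    refine Finset.sum_congr rfl fun τ _ => ?_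
    have hshift : 4 * (branches 2 τ : ℝ) * ((branches 2 τ : ℝ) - 1)
        * (((branches 2 τ - 1 : ℕ) : ℝ) - (n : ℝ) / 4) ^ k
        = 4 * (branches 2 τ : ℝ) * ((branches 2 τ : ℝ) - 1) * (x τ - 1) ^ k := by
      rcases Nat.eq_zero_or_pos (branches 2 τ) with h | h
      · simp [h]
      · rw [Nat.cast_sub h, hx]
        congr 2
        push_cast
        ring
    have hexp : (x τ - 1) ^ k
        = x τ ^ k + ∑ j ∈ Finset.range k, (-1) ^ (k - j) * (k.choose j : ℝ) * x τ ^ j := by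
      rw [sub_eq_add_neg, add_pow, Finset.sum_range_succ, add_comm]
      simp only [Nat.sub_self, pow_zero, mul_one, Nat.choose_self, Nat.cast_one]
      congr 1
      exact Finset.sum_congr rfl fun j _ => by ring
    have hS : (branches 2 τ : ℝ) = x τ + (n : ℝ) / 4 := by simp [hx]
    have hsum : ∑ j ∈ Finset.range k, (-1) ^ (k - j) * (k.choose j : ℝ) *
        (4 * x τ ^ (j + 2) + (2 * (n : ℝ) - 4) * x τ ^ (j + 1) + ((n : ℝ) ^ 2 / 4 - n) * x τ ^ j)
        = (4 * x τ ^ 2 + (2 * (n : ℝ) - 4) * x τ + ((n : ℝ) ^ 2 / 4 - n)) *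
          ∑ j ∈ Finset.range k, (-1) ^ (k - j) * (k.choose j : ℝ) * x τ ^ j := by
      rw [Finset.mul_sum]
      exact Finset.sum_congr rfl fun j _ => by ring
    rw [hshift, hexp, hsum, hS]
    ring
  have hm (j : ℕ) : centredMoment j n = (∑ τ ∈ treesOf n, x τ ^ j) * ((treesOf n).card : ℝ)⁻¹ :=
    div_eq_mul_inv _ _
  simp only [hm]
  rw [← mul_assoc, key, sub_mul, Finset.sum_mul, mul_assoc]
  congr 1
  exact Finset.sum_congr rfl fun j _ => by ring

/-- The contribution to the moment recursion of the lower order term of index `j`. -/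
noncomputable def momentTerm (j n : ℕ) : ℝ :=
  4 * centredMoment (j + 2) n + (2 * (n : ℝ) - 4) * centredMoment (j + 1) n
    + ((n : ℝ) ^ 2 / 4 - n) * centredMoment j n

theorem centredMoment_add_two (p n : ℕ) :
    (4 * (n : ℝ) - (4 * p + 10)) * centredMoment (p + 2) n = (n : ℝ) / 2 * centredMoment (p + 1) n
      + (p + 1) * ((2 * (n : ℝ) - 4) * centredMoment (p + 1) n + ((n : ℝ) ^ 2 / 4 - n) * centredMoment p n)
      - ∑ j ∈ Finset.range p, (-1) ^ (p + 1 - j) * ((p + 1).choose j : ℝ) * momentTerm j n := by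
  have h := centredMoment_succ (p + 1) n
  rw [Finset.sum_range_succ] at h
  simp only [Nat.add_sub_cancel_left, Nat.choose_succ_self_right, pow_one] at h
  simp only [momentTerm]
  push_cast at h
  linear_combination h

/-- The limit of the `j`-th moment divided by `n ^ (j / 2)`. -/
noncomputable def momentLimit (j : ℕ) : ℝ :=
  if Even j then ((j - 1).doubleFactorial : ℝ) / 16 ^ (j / 2)
  else (j.doubleFactorial : ℝ) / (8 * 16 ^ (j / 2))

theorem momentLimit_even (s : ℕ) :
    momentLimit (2 * s) = ((2 * s - 1).doubleFactorial : ℝ) / 16 ^ s := by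
  simp [momentLimit]

theorem momentLimit_odd (s : ℕ) :
    momentLimit (2 * s + 1) = ((2 * s + 1).doubleFactorial : ℝ) / (8 * 16 ^ s) := by
  have : (2 * s + 1) / 2 = s := by omega
  simp [momentLimit, this]

theorem momentLimit_even_succ (s : ℕ) :
    momentLimit (2 * s + 2) = (2 * s + 1) / 16 * momentLimit (2 * s) := by
  rw [show 2 * s + 2 = 2 * (s + 1) by ring, momentLimit_even, momentLimit_even,
    show 2 * (s + 1) - 1 = 2 * s + 1 by omega, Nat.doubleFactorial_add_one]
  push_cast
  rw [pow_succ]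
  field_simp

theorem momentLimit_odd_eq (s : ℕ) :
    momentLimit (2 * s + 1) = (2 * s + 1) / 8 * momentLimit (2 * s) := by
  rw [momentLimit_odd, momentLimit_even, Nat.doubleFactorial_add_one]
  push_cast
  field_simp

/-- Convergence of the normalised `j`-th moment. -/
def MomentConverges (j : ℕ) : Prop :=
  Tendsto (fun n : ℕ => centredMoment j n / (n : ℝ) ^ (j / 2)) atTop (𝓝 (momentLimit j))

theorem MomentConverges.tendsto {j : ℕ} (h : MomentConverges j) {i d : ℕ} (hd : i + j / 2 = d) :
    Tendsto (fun n : ℕ => (n : ℝ) ^ i * centredMoment j n / (n : ℝ) ^ d) atTop (𝓝 (momentLimit j)) := by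
  refine Tendsto.congr' ?_ h
  filter_upwards [eventually_ge_atTop 1] with n hn
  have : (n : ℝ) ≠ 0 := by positivity
  rw [← hd, pow_add, mul_div_mul_left _ _ (pow_ne_zero _ this)]

theorem MomentConverges.tendsto_zero {j : ℕ} (h : MomentConverges j) {i d : ℕ}
    (hd : i + j / 2 < d) :
    Tendsto (fun n : ℕ => (n : ℝ) ^ i * centredMoment j n / (n : ℝ) ^ d) atTop (𝓝 0) := by
  have h1 : Tendsto (fun n : ℕ => ((n : ℝ) ^ (d - (i + j / 2)))⁻¹) atTop (𝓝 0) :=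
    ((tendsto_pow_atTop (by omega)).comp tendsto_natCast_atTop_atTop).inv_tendsto_atTop
  have h2 := (h.tendsto rfl (i := i)).mul h1
  rw [mul_zero] at h2
  refine h2.congr fun n => ?_
  rw [← div_eq_mul_inv, div_div, ← pow_add, Nat.add_sub_cancel' hd.le]

theorem tendsto_momentTerm_zero {j d : ℕ} (h0 : MomentConverges j) (h1 : MomentConverges (j + 1))
    (h2 : MomentConverges (j + 2)) (hd : j / 2 + 2 < d) :
    Tendsto (fun n : ℕ => momentTerm j n / (n : ℝ) ^ d) atTop (𝓝 0) := by
  have t := ((((h2.tendsto_zero (i := 0) (d := d) (by omega)).const_mul 4).add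
    ((h1.tendsto_zero (i := 1) (d := d) (by omega)).const_mul 2)).sub
    ((h1.tendsto_zero (i := 0) (d := d) (by omega)).const_mul 4)).add
    (((h0.tendsto_zero (i := 2) (d := d) (by omega)).const_mul (1 / 4)).sub
    (h0.tendsto_zero (i := 1) (d := d) (by omega)))
  refine (t.congr fun n => ?_).trans (by simp)
  simp only [momentTerm]
  ring

theorem tendsto_momentTerm_even {s : ℕ} (h0 : MomentConverges (2 * s))
    (h1 : MomentConverges (2 * s + 1)) (h2 : MomentConverges (2 * s + 2)) :
    Tendsto (fun n : ℕ => momentTerm (2 * s) n / (n : ℝ) ^ (s + 2)) atTop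
      (𝓝 (momentLimit (2 * s) / 4)) := by
  have t := ((((h2.tendsto_zero (i := 0) (d := s + 2) (by omega)).const_mul 4).add
    ((h1.tendsto_zero (i := 1) (d := s + 2) (by omega)).const_mul 2)).sub
    ((h1.tendsto_zero (i := 0) (d := s + 2) (by omega)).const_mul 4)).add
    (((h0.tendsto (i := 2) (d := s + 2) (by omega)).const_mul (1 / 4)).sub
    (h0.tendsto_zero (i := 1) (d := s + 2) (by omega)))
  refine (t.congr fun n => ?_).trans (by ring_nf; exact le_rfl)
  simp only [momentTerm]
  ring

theorem tendsto_of_linear_mul {f : ℕ → ℝ} {c L : ℝ} {w : ℕ}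
    (h : Tendsto (fun n : ℕ => (4 * (n : ℝ) - c) * f n / (n : ℝ) ^ (w + 1)) atTop (𝓝 L)) :
    Tendsto (fun n : ℕ => f n / (n : ℝ) ^ w) atTop (𝓝 (L / 4)) := by
  have h1 : Tendsto (fun n : ℕ => 4 - c / (n : ℝ)) atTop (𝓝 4) := by
    simpa using (tendsto_const_div_atTop_nhds_zero_nat c).const_sub 4
  refine (h.div h1 four_ne_zero).congr' ?_
  filter_upwards [eventually_ge_atTop 1, h1.eventually_ne four_ne_zero] with n hn hne
  have hn0 : (n : ℝ) ≠ 0 := by positivity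
  have hfac : 4 * (n : ℝ) - c = (4 - c / n) * n := by field_simp
  simp only [Pi.div_apply]
  rw [hfac, pow_succ, div_div, mul_right_comm, div_eq_div_iff (by positivity) (by positivity)]
  ring

theorem tendsto_sum_momentTerm_zero {s d : ℕ} (hs : s + 2 ≤ d) (b : ℕ → ℝ)
    (ih : ∀ j, j < 2 * s + 2 → MomentConverges j) :
    Tendsto (fun n : ℕ => ∑ j ∈ Finset.range (2 * s), b j * (momentTerm j n / (n : ℝ) ^ d)) atTop
      (𝓝 0) := by
  rw [← Finset.sum_const_zero (s := Finset.range (2 * s))]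
  refine tendsto_finsetSum _ fun j hj => ?_
  rw [Finset.mem_range] at hj
  simpa using (tendsto_momentTerm_zero (d := d) (ih j (by omega)) (ih (j + 1) (by omega))
    (ih (j + 2) (by omega)) (by omega)).const_mul (b j)

theorem momentConverges_zero : MomentConverges 0 := by
  refine tendsto_const_nhds.congr' ?_
  filter_upwards [eventually_ge_atTop 1] with n hn
  simp [centredMoment_zero hn, momentLimit]

theorem momentConverges_one : MomentConverges 1 := by
  have h : Tendsto (fun n : ℕ => (4 * (n : ℝ) - 6) * centredMoment 1 n / (n : ℝ) ^ (0 + 1)) atTop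
      (𝓝 (1 / 2)) := by
    refine tendsto_const_nhds.congr' ?_
    filter_upwards [eventually_ge_atTop 1] with n hn
    have hn0 : (n : ℝ) ≠ 0 := by positivity
    have h := centredMoment_succ 0 n
    simp only [Finset.range_zero, Finset.sum_empty, centredMoment_zero hn, zero_add] at h
    rw [h]
    field_simp
    simp
  have := tendsto_of_linear_mul h
  have hl : momentLimit 1 = 1 / 2 / 4 := by norm_num [momentLimit]
  rw [MomentConverges, hl]
  exact this

theorem momentConverges_even_succ {s : ℕ} (ih : ∀ j, j < 2 * s + 2 → MomentConverges j) :
    MomentConverges (2 * s + 2) := by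
  have h0 := ih (2 * s) (by omega)
  have h1 := ih (2 * s + 1) (by omega)
  have t := ((((h1.tendsto_zero (i := 1) (d := s + 2) (by omega)).const_mul (1 / 2)).add
    ((((h1.tendsto_zero (i := 1) (d := s + 2) (by omega)).const_mul 2).sub
    ((h1.tendsto_zero (i := 0) (d := s + 2) (by omega)).const_mul 4)).const_mul
      (2 * (s : ℝ) + 1))).add
    ((((h0.tendsto (i := 2) (d := s + 2) (by omega)).const_mul (1 / 4)).sub
    (h0.tendsto_zero (i := 1) (d := s + 2) (by omega))).const_mul (2 * (s : ℝ) + 1))).sub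
    (tendsto_sum_momentTerm_zero (d := s + 2) le_rfl
      (fun j => (-1) ^ (2 * s + 1 - j) * ((2 * s + 1).choose j : ℝ)) ih)
  have hg := t.congr (f₂ := fun n : ℕ =>
    (4 * (n : ℝ) - (4 * (2 * s : ℕ) + 10)) * centredMoment (2 * s + 2) n / (n : ℝ) ^ (s + 1 + 1))
    fun n => by
      rw [centredMoment_add_two, sub_div, Finset.sum_div]
      simp only [← mul_div_assoc]
      congr 1
      push_cast
      ring
  have hlim := tendsto_of_linear_mul hg
  rw [MomentConverges, show (2 * s + 2) / 2 = s + 1 by omega, momentLimit_even_succ]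
  convert hlim using 2
  ring

theorem momentConverges_odd_succ {s : ℕ} (ih : ∀ j, j < 2 * s + 3 → MomentConverges j) :
    MomentConverges (2 * s + 3) := by
  have h0 := ih (2 * s) (by omega)
  have h1 := ih (2 * s + 1) (by omega)
  have h2 := ih (2 * s + 2) (by omega)
  have t := (((((h2.tendsto (i := 1) (d := s + 2) (by omega)).const_mul (1 / 2)).add
    ((((h2.tendsto (i := 1) (d := s + 2) (by omega)).const_mul 2).sub
    ((h2.tendsto_zero (i := 0) (d := s + 2) (by omega)).const_mul 4)).const_mul
      (2 * (s : ℝ) + 2))).add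
    ((((h1.tendsto (i := 2) (d := s + 2) (by omega)).const_mul (1 / 4)).sub
    (h1.tendsto_zero (i := 1) (d := s + 2) (by omega))).const_mul (2 * (s : ℝ) + 2))).sub
    (tendsto_sum_momentTerm_zero (d := s + 2) le_rfl
      (fun j => (-1) ^ (2 * s + 2 - j) * ((2 * s + 2).choose j : ℝ))
      fun j hj => ih j (by omega))).sub
    ((tendsto_momentTerm_even h0 h1 h2).const_mul (((s : ℝ) + 1) * (2 * s + 1)))
  have hchoose : ((2 * s + 2).choose (2 * s) : ℝ) = ((s : ℝ) + 1) * (2 * s + 1) := by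
    rw [Nat.choose_symm_add, Nat.cast_choose_two]
    push_cast
    ring
  have hg := t.congr (f₂ := fun n : ℕ =>
    (4 * (n : ℝ) - (4 * (2 * s + 1 : ℕ) + 10)) * centredMoment (2 * s + 3) n / (n : ℝ) ^ (s + 1 + 1))
    fun n => by
      rw [centredMoment_add_two, sub_div, Finset.sum_range_succ, add_div (Finset.sum _ _), Finset.sum_div,
        show 2 * s + 1 + 1 = 2 * s + 2 by ring, hchoose, Nat.add_sub_cancel_left]
      simp only [← mul_div_assoc]
      rw [← sub_sub]
      push_cast
      ring
  have hlim := tendsto_of_linear_mul hg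
  rw [MomentConverges, show (2 * s + 3) / 2 = s + 1 by omega,
    show 2 * s + 3 = 2 * (s + 1) + 1 by ring, momentLimit_odd_eq,
    show 2 * (s + 1) = 2 * s + 2 by ring]
  rw [momentLimit_odd_eq, momentLimit_even_succ] at hlim
  rw [momentLimit_even_succ]
  convert hlim using 2
  push_cast
  ring

theorem momentConverges (j : ℕ) : MomentConverges j := by
  induction j using Nat.strong_induction_on with
  | _ j ih =>
    rcases Nat.even_or_odd' j with ⟨s, rfl | rfl⟩
    · cases s with
      | zero => exact momentConverges_zero
      | succ s => exact momentConverges_even_succ ih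
    · cases s with
      | zero => exact momentConverges_one
      | succ s => exact momentConverges_odd_succ ih

theorem expect_branches_pow_mul (l k n : ℕ) :
    expect n (fun τ => (branches 2 τ : ℝ) ^ l * ((branches 2 τ : ℝ) - (n : ℝ) / 4) ^ k)
      = ∑ j ∈ Finset.range (l + 1),
        (l.choose j : ℝ) * ((n : ℝ) / 4) ^ (l - j) * centredMoment (j + k) n := by
  simp only [centredMoment, expect, div_eq_mul_inv _ ((treesOf n).card : ℝ)]
  simp only [← mul_assoc, ← Finset.sum_mul]
  congr 1
  simp only [Finset.mul_sum]
  rw [Finset.sum_comm]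
  refine Finset.sum_congr rfl fun τ _ => ?_
  set y := (branches 2 τ : ℝ) - (n : ℝ) / 4 with hy
  rw [show (branches 2 τ : ℝ) = y + (n : ℝ) / 4 by simp [hy], add_pow, Finset.sum_mul]
  exact Finset.sum_congr rfl fun j _ => by ring

theorem tendsto_expect_branches_pow_mul (s l : ℕ) :
    Tendsto (fun n : ℕ =>
        expect n (fun τ =>
          (branches 2 τ : ℝ) ^ l * ((branches 2 τ : ℝ) - (n : ℝ) / 4) ^ (2 * s + 1))
          / (n : ℝ) ^ (l + s))
      atTop (𝓝 (momentLimit (2 * s + 1) * (2 * l + 1) / 4 ^ l)) := by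
  have hterm (j n : ℕ) : (l.choose j : ℝ) * ((n : ℝ) / 4) ^ (l - j) * centredMoment (j + (2 * s + 1)) n
      / (n : ℝ) ^ (l + s) = (l.choose j : ℝ) / 4 ^ (l - j) *
        ((n : ℝ) ^ (l - j) * centredMoment (j + (2 * s + 1)) n / (n : ℝ) ^ (l + s)) := by
    rw [div_pow]; ring
  simp only [expect_branches_pow_mul, Finset.sum_div, hterm]
  cases l with
  | zero => simpa using (momentConverges (0 + (2 * s + 1))).tendsto (i := 0) (d := 0 + s) (by omega)
  | succ l =>
    simp only [Finset.sum_range_succ' _ (l + 1), Finset.sum_range_succ' _ l]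
    have t0 := ((momentConverges (0 + (2 * s + 1))).tendsto (i := l + 1 - 0) (d := l + 1 + s)
      (by omega)).const_mul (((l + 1).choose 0 : ℝ) / 4 ^ (l + 1 - 0))
    have t1 := ((momentConverges (0 + 1 + (2 * s + 1))).tendsto (i := l + 1 - (0 + 1))
      (d := l + 1 + s) (by omega)).const_mul
      (((l + 1).choose (0 + 1) : ℝ) / 4 ^ (l + 1 - (0 + 1)))
    have t2 := tendsto_finsetSum (Finset.range l) fun j hj =>
      ((momentConverges (j + 1 + 1 + (2 * s + 1))).tendsto_zero (i := l + 1 - (j + 1 + 1))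
        (d := l + 1 + s) (by have := Finset.mem_range.1 hj; omega)).const_mul
        (((l + 1).choose (j + 1 + 1) : ℝ) / 4 ^ (l + 1 - (j + 1 + 1)))
    convert (t2.add t1).add t0 using 2
    rw [show 0 + 1 + (2 * s + 1) = 2 * s + 2 by ring, zero_add (2 * s + 1), momentLimit_odd_eq,
      momentLimit_even_succ]
    simp only [mul_zero, Finset.sum_const_zero, zero_add, Nat.choose_one_right,
      Nat.choose_zero_right, Nat.add_sub_cancel, Nat.sub_zero]
    push_cast
    field_simp
    ring

/-- Mixed odd moments (Lemma 4, odd case): for fixed `s, l ≥ 0`,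
`⟨S_{2,n}^l (S_{2,n} − n/4)^{2s+1}⟩ ∼ (n/4)^l ((2s+1)!!/(2·4^{2s+1})) (2l+1) n^s`. -/
theorem mixed_odd_moments_S2 (s l : ℕ) :
    Tendsto (fun n : ℕ =>
        expect n (fun τ =>
            (BinTree.branches 2 τ : ℝ) ^ l * ((BinTree.branches 2 τ : ℝ) - (n : ℝ) / 4) ^ (2*s+1))
          / (((n : ℝ) / 4) ^ l * ((Nat.doubleFactorial (2*s + 1) : ℝ) / (2 * 4 ^ (2*s+1)))
              * (2 * (l : ℝ) + 1) * (n : ℝ) ^ s))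
      atTop (𝓝 1) := by
  have hc : momentLimit (2 * s + 1) * (2 * (l : ℝ) + 1) / 4 ^ l ≠ 0 := by
    rw [momentLimit_odd]
    have := Nat.doubleFactorial_pos (2 * s + 1)
    positivity
  have h := (tendsto_expect_branches_pow_mul s l).div_const
    (momentLimit (2 * s + 1) * (2 * (l : ℝ) + 1) / 4 ^ l)
  rw [div_self hc] at h
  refine h.congr fun n => ?_
  rw [div_div]
  congr 1
  rw [momentLimit_odd, div_pow, pow_add (n : ℝ), show (16 : ℝ) = 4 ^ 2 by norm_num, ← pow_mul,
    pow_succ 4 (2 * s)]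
  field_simp
  ring
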